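/- Let p>1 and Q>1. Let q satisfy 1 ≤ q < 1/s⁺_p(Q). Then there is a constant C = C(p,q,Q), independent of the dimension n and of the measure μ, such that: for every n ≥ 1, every Radon measure μ on ℝⁿ with μ(H) = 0 for every hyperplane H orthogonal to one of the coordinate axes, and every weight w with strong Reverse Hölder characteristic [w]_{RH_p} ≤ Q, one has [w]_{RH_q} ≤ C; in particular w belongs to the strong Reverse Hölder class RH_q* with respect to μ. -/

import Mathlib

open MeasureTheory Set Filter

noncomputable section

/-- An axis-parallel open rectangular box in `ℝⁿ` (modelled as `Fin n → ℝ`). -/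
def IsBox {n : ℕ} (R : Set (Fin n → ℝ)) : Prop :=
  ∃ a b : Fin n → ℝ, (∀ i, a i < b i) ∧ R = univ.pi fun i => Ioo (a i) (b i)

/-- The average `⟨f⟩_R = (1/μ(R)) ∫_R f dμ`. -/
def boxAvg {n : ℕ} (μ : Measure (Fin n → ℝ)) (R : Set (Fin n → ℝ))
    (f : (Fin n → ℝ) → ℝ) : ℝ :=
  ⨍ x in R, f x ∂μ

/-- Every hyperplane orthogonal to one of the coordinate axes is `μ`-null. -/
def NullHyperplanes {n : ℕ} (μ : Measure (Fin n → ℝ)) : Prop :=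
  ∀ (i : Fin n) (c : ℝ), μ {x | x i = c} = 0

/-- `[w]_p ≤ Q`: the strong Muckenhoupt characteristic of `w` w.r.t. `μ` is at most `Q`;
this includes the requisite integrability of `w` and `w^{-1/(p-1)}` on every box. -/
def ApBound {n : ℕ} (μ : Measure (Fin n → ℝ)) (w : (Fin n → ℝ) → ℝ) (p Q : ℝ) : Prop :=
  ∀ R : Set (Fin n → ℝ), IsBox R → 0 < μ R → μ R < ⊤ →
    IntegrableOn w R μ ∧ IntegrableOn (fun x => w x ^ (-1 / (p - 1))) R μ ∧
    boxAvg μ R w * (boxAvg μ R fun x => w x ^ (-1 / (p - 1))) ^ (p - 1) ≤ Q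

/-- `[w]_{RH_p} ≤ Q`: the strong Reverse Hölder characteristic of `w` w.r.t. `μ` is
at most `Q`, i.e. `⟨w^p⟩_R^{1/p} ≤ Q⟨w⟩_R` on every box. -/
def RHBound {n : ℕ} (μ : Measure (Fin n → ℝ)) (w : (Fin n → ℝ) → ℝ) (p Q : ℝ) : Prop :=
  ∀ R : Set (Fin n → ℝ), IsBox R → 0 < μ R → μ R < ⊤ →
    IntegrableOn w R μ ∧ IntegrableOn (fun x => w x ^ p) R μ ∧
    (boxAvg μ R fun x => w x ^ p) ^ (1 / p) ≤ Q * boxAvg μ R w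


/-- The tangent line to `x ↦ x ^ p` at `a`, evaluated at `1`. -/
def tangentAtOne (p a : ℝ) : ℝ := p * a ^ (p - 1) - (p - 1) * a ^ p

/-- A family of functions affine in `r`, indexed by `a`, whose lower envelope over `a ≥ 1` is,
up to normalization, the restriction to `x = 1` of a Bellman function for the domain
`x ^ p ≤ y ≤ E * x ^ p`. -/
def bellmanPlane (p q E a r : ℝ) : ℝ :=
  q * (q - 1) / E * a ^ (q - p) * r - p * q * (q - p) * a ^ (q - 1) +
    (p - 1) * (q - 1) * (q - p) * a ^ q

lemma hasDerivAt_tangentAtOne {p a : ℝ} (ha : 0 < a) :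
    HasDerivAt (tangentAtOne p) (p * (p - 1) * a ^ (p - 2) * (1 - a)) a := by
  have h1 := (Real.hasDerivAt_rpow_const (x := a) (p := p - 1) (Or.inl ha.ne')).const_mul p
  have h2 := (Real.hasDerivAt_rpow_const (x := a) (p := p) (Or.inl ha.ne')).const_mul (p - 1)
  refine (h1.sub h2).congr_deriv ?_
  rw [show p - 1 - 1 = p - 2 by ring, show p - 1 = (p - 2) + 1 by ring, Real.rpow_add_one ha.ne']
  ring

lemma antitoneOn_tangentAtOne {p : ℝ} (hp : 1 < p) : AntitoneOn (tangentAtOne p) (Ici 1) := by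
  have hd : ∀ a ∈ Ici (1 : ℝ), HasDerivAt (tangentAtOne p) _ a := fun a ha =>
    hasDerivAt_tangentAtOne (lt_of_lt_of_le one_pos ha)
  refine antitoneOn_of_deriv_nonpos (convex_Ici 1)
    (fun a ha => (hd a ha).continuousAt.continuousWithinAt)
    (fun a ha => (hd a (interior_subset ha)).differentiableAt.differentiableWithinAt) ?_
  intro a ha
  have ha1 : 1 ≤ a := interior_subset (s := Ici (1 : ℝ)) ha
  rw [(hd a ha1).deriv]
  have : 0 ≤ p * (p - 1) * a ^ (p - 2) := by
    have : 0 < p - 1 := by linarith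
    positivity
  exact mul_nonpos_of_nonneg_of_nonpos this (by linarith)

lemma hasDerivAt_bellmanPlane {p q E a : ℝ} (r : ℝ) (ha : 0 < a) :
    HasDerivAt (fun a => bellmanPlane p q E a r)
      (q * (q - 1) * (q - p) * a ^ (q - p - 1) * (r / E - tangentAtOne p a)) a := by
  have h1 := ((Real.hasDerivAt_rpow_const (x := a) (p := q - p) (Or.inl ha.ne')).const_mul
    (q * (q - 1) / E)).mul_const r
  have h2 := (Real.hasDerivAt_rpow_const (x := a) (p := q - 1) (Or.inl ha.ne')).const_mul
    (p * q * (q - p))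
  have h3 := (Real.hasDerivAt_rpow_const (x := a) (p := q) (Or.inl ha.ne')).const_mul
    ((p - 1) * (q - 1) * (q - p))
  refine ((h1.sub h2).add h3).congr_deriv ?_
  rw [show q - 1 - 1 = (q - p - 1) + (p - 1) by ring, show q - 1 = (q - p - 1) + p by ring,
    Real.rpow_add ha, Real.rpow_add ha, tangentAtOne]
  ring

lemma antitoneOn_bellmanPlane {p q E r u v : ℝ} (hp : 1 < p) (hq : p < q) (hu : 1 ≤ u)
    (hv : r / E ≤ tangentAtOne p v) :
    AntitoneOn (fun a => bellmanPlane p q E a r) (Icc u v) := by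
  have hd : ∀ a ∈ Icc u v, HasDerivAt (fun a => bellmanPlane p q E a r) _ a := fun a ha =>
    hasDerivAt_bellmanPlane r (lt_of_lt_of_le one_pos (hu.trans ha.1))
  refine antitoneOn_of_deriv_nonpos (convex_Icc u v)
    (fun a ha => (hd a ha).continuousAt.continuousWithinAt)
    (fun a ha => (hd a (interior_subset ha)).differentiableAt.differentiableWithinAt) ?_
  intro a ha
  have ha' : a ∈ Icc u v := interior_subset ha
  have ha1 : 1 ≤ a := hu.trans ha'.1
  rw [(hd a ha').deriv]
  have h0 : 0 ≤ q * (q - 1) * (q - p) * a ^ (q - p - 1) := by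
    have : 0 < q - 1 := by linarith
    have : 0 < q - p := by linarith
    have : 0 < q := by linarith
    positivity
  have := antitoneOn_tangentAtOne hp ha1 (ha1.trans ha'.2) ha'.2
  exact mul_nonpos_of_nonneg_of_nonpos h0 (by linarith)

lemma monotoneOn_bellmanPlane {p q E r u : ℝ} (hp : 1 < p) (hq : p < q) (hu : 1 ≤ u)
    (hur : tangentAtOne p u ≤ r / E) :
    MonotoneOn (fun a => bellmanPlane p q E a r) (Ici u) := by
  have hd : ∀ a ∈ Ici u, HasDerivAt (fun a => bellmanPlane p q E a r) _ a := fun a ha =>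
    hasDerivAt_bellmanPlane r (lt_of_lt_of_le one_pos (hu.trans ha))
  refine monotoneOn_of_deriv_nonneg (convex_Ici u)
    (fun a ha => (hd a ha).continuousAt.continuousWithinAt)
    (fun a ha => (hd a (interior_subset ha)).differentiableAt.differentiableWithinAt) ?_
  intro a ha
  have ha' : u ≤ a := interior_subset (s := Ici u) ha
  have ha1 : 1 ≤ a := hu.trans ha'
  rw [(hd a ha').deriv]
  have h0 : 0 ≤ q * (q - 1) * (q - p) * a ^ (q - p - 1) := by
    have : 0 < q - 1 := by linarith
    have : 0 < q - p := by linarith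
    have : 0 < q := by linarith
    positivity
  have := antitoneOn_tangentAtOne hp hu ha1 ha'
  exact mul_nonneg h0 (by linarith)

lemma tangentAtOne_inv {p l : ℝ} (hl : 0 < l) :
    tangentAtOne p l⁻¹ = (p * l - (p - 1)) / l ^ p := by
  have := (Real.rpow_pos_of_pos hl p).ne'
  rw [tangentAtOne, Real.rpow_sub_one (inv_pos.2 hl).ne', Real.inv_rpow hl.le]
  field_simp

lemma bellmanPlane_inv {p q s : ℝ} (hs : s < 1) (hps : p * s < 1) :
    bellmanPlane p q ((1 - s) ^ p / (1 - p * s)) (1 - s)⁻¹ 1 =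
      p * (p - 1) * (1 - q * s) / (1 - s) ^ q := by
  have hl : 0 < 1 - s := by linarith
  have h1 := (Real.rpow_pos_of_pos hl p).ne'
  have h2 := (Real.rpow_pos_of_pos hl q).ne'
  have h3 : 1 - p * s ≠ 0 := by linarith
  rw [bellmanPlane, Real.rpow_sub_one (inv_pos.2 hl).ne', Real.rpow_sub (inv_pos.2 hl),
    Real.inv_rpow hl.le, Real.inv_rpow hl.le]
  field_simp
  ring

/-- The lower envelope of the planes stays above a positive constant on the lower boundary. -/
lemma bellmanPlane_lower_bound {p q s a r : ℝ} (hp : 1 < p) (hq : p < q) (hs : 0 ≤ s)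
    (hps : p * s < 1) (ha : 1 ≤ a) (hr : 1 ≤ r) :
    p * (p - 1) * (1 - q * s) / (1 - s) ^ q ≤
      bellmanPlane p q ((1 - s) ^ p / (1 - p * s)) a r := by
  have hs1 : s < 1 := by nlinarith
  have hl : 0 < 1 - s := by linarith
  have h1l : 1 ≤ (1 - s)⁻¹ := (one_le_inv₀ hl).2 (by linarith)
  rw [← bellmanPlane_inv hs1 hps]
  set E := (1 - s) ^ p / (1 - p * s) with hE
  have hE0 : 0 < E := div_pos (Real.rpow_pos_of_pos hl p) (by linarith)
  have htan : tangentAtOne p (1 - s)⁻¹ = 1 / E := by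
    rw [tangentAtOne_inv hl, hE, one_div_div]
    ring
  have h1 : bellmanPlane p q E (1 - s)⁻¹ 1 ≤ bellmanPlane p q E a 1 := by
    rcases le_total a (1 - s)⁻¹ with h | h
    · exact antitoneOn_bellmanPlane hp hq le_rfl htan.ge ⟨ha, h⟩ ⟨h1l, le_rfl⟩ h
    · exact monotoneOn_bellmanPlane hp hq h1l htan.le (mem_Ici.2 le_rfl) h h
  refine h1.trans ?_
  have : 0 ≤ q * (q - 1) / E * a ^ (q - p) := by
    have : 0 < q - 1 := by linarith
    have : 0 < q := by linarith
    positivity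
  unfold bellmanPlane
  nlinarith

lemma strictMonoOn_powerWeight {p : ℝ} (hp : 1 < p) :
    StrictMonoOn (fun s : ℝ => (1 - s) ^ p / (1 - p * s)) (Ico 0 (1 / p)) := by
  have hp0 : 0 < p := by linarith
  have key : ∀ s ∈ Ico 0 (1 / p), 0 < 1 - p * s ∧ 0 < 1 - s := by
    rintro s ⟨h0, h1⟩
    rw [lt_div_iff₀ hp0] at h1
    constructor <;> nlinarith
  have hd : ∀ s ∈ Ico 0 (1 / p), HasDerivAt (fun s : ℝ => (1 - s) ^ p / (1 - p * s))
      (p * (p - 1) * s * (1 - s) ^ (p - 1) / (1 - p * s) ^ 2) s := by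
    intro s hs
    obtain ⟨h1, h2⟩ := key s hs
    have e1 : HasDerivAt (fun s : ℝ => 1 - s) (-1) s := by
      simpa using (hasDerivAt_id s).const_sub 1
    have e2 : HasDerivAt (fun s : ℝ => 1 - p * s) (-p) s := by
      simpa using ((hasDerivAt_id s).const_mul p).const_sub 1
    refine ((e1.rpow_const (p := p) (Or.inl h2.ne')).div e2 h1.ne').congr_deriv ?_
    rw [show (1 - s) ^ p = (1 - s) ^ (p - 1) * (1 - s) by
      rw [← Real.rpow_add_one h2.ne']; ring_nf]
    ring
  refine strictMonoOn_of_deriv_pos (convex_Ico _ _)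
    (fun s hs => (hd s hs).continuousAt.continuousWithinAt) ?_
  intro s hs
  rw [interior_Ico] at hs
  have hs' : s ∈ Ico 0 (1 / p) := ⟨hs.1.le, hs.2⟩
  obtain ⟨h1, h2⟩ := key s hs'
  rw [(hd s hs').deriv]
  have := hs.1
  have : 0 < p - 1 := by linarith
  positivity

/-- Parameters of the Bellman function. -/
lemma exists_bellman_parameters {p Q sp q : ℝ} (hp : 1 < p) (hQ : 1 < Q)
    (hsp : (1 - p * sp) ^ (1 / p) * (1 - sp)⁻¹ = 1 / Q) (hpq : p < q) (hq : q < 1 / sp) :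
    ∃ E κ c : ℝ, 0 < E ∧ 1 < κ ∧ κ ≤ 2 ∧ 0 < c ∧
      (∀ a r, 1 ≤ a → a ≤ κ → r ≤ Q ^ p → bellmanPlane p q E κ r ≤ bellmanPlane p q E a r) ∧
      (∀ a r, 1 ≤ a → 1 ≤ r → c ≤ bellmanPlane p q E a r) := by
  have hp0 : 0 < p := by linarith
  have hq0 : 0 < q := by linarith
  have hQ0 : 0 < Q := by linarith
  have hsp0 : 0 < sp := by
    by_contra h
    have : 1 / sp ≤ 0 := div_nonpos_of_nonneg_of_nonpos one_pos.le (not_lt.1 h)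
    linarith
  have hqs : sp < 1 / q := by
    rw [lt_div_iff₀ hsp0] at hq
    rw [lt_div_iff₀ hq0]; linarith
  have hqp : 1 / q < 1 / p := one_div_lt_one_div_of_lt hp0 hpq
  obtain ⟨s, hs1, hs2⟩ := exists_between hqs
  have hps : p * s < 1 := by
    have := hs2.trans hqp
    rw [lt_div_iff₀ hp0] at this
    linarith
  have hpsp : p * sp < 1 := by nlinarith
  have hqs' : q * s < 1 := by
    rw [lt_div_iff₀ hq0] at hs2; linarith
  have hs_one : s < 1 := by nlinarith
  have hlt := strictMonoOn_powerWeight hp ⟨hsp0.le, hqs.trans hqp⟩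
    ⟨(hsp0.trans hs1).le, hs2.trans hqp⟩ hs1
  have hK : (1 - sp) ^ p / (1 - p * sp) = Q ^ p := by
    have h1 : 0 < 1 - sp := by linarith
    have h2 : 0 < 1 - p * sp := by linarith
    have h3 : Q * (1 - p * sp) ^ (1 / p) = 1 - sp := by
      field_simp at hsp
      linarith
    rw [← h3, Real.mul_rpow hQ0.le (by positivity), ← Real.rpow_mul h2.le,
      one_div_mul_cancel hp0.ne', Real.rpow_one]
    field_simp
  simp only [hK] at hlt
  set E := (1 - s) ^ p / (1 - p * s) with hE
  have hE0 : 0 < E := (Real.rpow_pos_of_pos hQ0 p).trans hlt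
  have hone : Q ^ p / E < tangentAtOne p 1 := by
    rw [tangentAtOne]
    simpa using (div_lt_one hE0).2 hlt
  have hev : ∀ᶠ a in nhdsWithin 1 (Ioi 1), Q ^ p / E < tangentAtOne p a :=
    ((hasDerivAt_tangentAtOne one_pos).continuousAt.eventually
      (lt_mem_nhds hone)).filter_mono nhdsWithin_le_nhds
  have hev2 : ∀ᶠ a in nhdsWithin (1 : ℝ) (Ioi 1), a ∈ Ioo (1 : ℝ) 2 :=
    Ioo_mem_nhdsGT (by norm_num)
  obtain ⟨κ, hκ, hκ1, hκ2⟩ := (hev.and hev2).exists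
  refine ⟨E, κ, p * (p - 1) * (1 - q * s) / (1 - s) ^ q, hE0, hκ1, hκ2.le, ?_, ?_, ?_⟩
  · have : 0 < p - 1 := by linarith
    have : 0 < 1 - q * s := by linarith
    have : 0 < 1 - s := by linarith
    positivity
  · intro a r ha1 ha2 hr
    exact antitoneOn_bellmanPlane hp hpq le_rfl ((div_le_div_of_nonneg_right hr hE0.le).trans hκ.le)
      ⟨ha1, ha2⟩ ⟨hκ1.le, le_rfl⟩ ha2
  · intro a r ha hr
    exact bellmanPlane_lower_bound hp hpq (hsp0.trans hs1).le hps ha hr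

lemma exists_balanced_cut {f m : ℝ → ℝ} {α β F M κ : ℝ} (hαβ : α ≤ β) (hf : Continuous f)
    (hm : Continuous m) (hfm : Monotone f) (hmm : Monotone m) (hfα : f α = 0) (hmα : m α = 0)
    (hfβ : f β = F) (hmβ : m β = M) (hF : 0 < F) (hM : 0 < M) (hκ : 1 < κ) (hκ2 : κ ≤ 2) :
    ∃ t ∈ Ioo α β, (1 - 1 / κ) * M ≤ m t ∧ (1 - 1 / κ) * M ≤ M - m t ∧
      f t * M ≤ κ * F * m t ∧ (F - f t) * M ≤ κ * F * (M - m t) := by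
  have hκ0 : 0 < κ := by linarith
  have hκi : κ * (1 / κ) = 1 := by field_simp
  have hκh : 1 / 2 ≤ 1 / κ := one_div_le_one_div_of_le hκ0 hκ2
  have hκ1 : 1 / κ < 1 := by rw [div_lt_one hκ0]; exact hκ
  suffices h : ∃ t ∈ Icc α β, (1 - 1 / κ) * M ≤ m t ∧ (1 - 1 / κ) * M ≤ M - m t ∧
      f t * M ≤ κ * F * m t ∧ (F - f t) * M ≤ κ * F * (M - m t) by
    obtain ⟨t, ht, h1, h2, h3, h4⟩ := h
    have hpos : 0 < (1 - 1 / κ) * M := mul_pos (by linarith) hM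
    refine ⟨t, ⟨lt_of_le_of_ne ht.1 ?_, lt_of_le_of_ne ht.2 ?_⟩, h1, h2, h3, h4⟩
    · rintro rfl; linarith
    · rintro rfl; linarith
  obtain ⟨t₀, ht₀, hmt₀⟩ : M / 2 ∈ m '' Icc α β := by
    refine intermediate_value_Icc hαβ hm.continuousOn ⟨?_, ?_⟩ <;> linarith
  have hF0 : ∀ t ∈ Icc α β, 0 ≤ f t ∧ f t ≤ F := fun t ht => ⟨hfα ▸ hfm ht.1, hfβ ▸ hfm ht.2⟩
  by_cases h1 : f t₀ * M ≤ κ * F * m t₀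
  · by_cases h2 : (F - f t₀) * M ≤ κ * F * (M - m t₀)
    · exact ⟨t₀, ht₀, by rw [hmt₀]; nlinarith, by rw [hmt₀]; nlinarith, h1, h2⟩
    · push Not at h2
      obtain ⟨t, ht, hgt⟩ : 0 ∈ (fun t => (F - f t) * M - κ * F * (M - m t)) '' Icc α t₀ := by
        refine intermediate_value_Icc ht₀.1 (by fun_prop) ⟨?_, ?_⟩
        · simp only [hfα, hmα]
          nlinarith [mul_pos hF hM]
        · linarith
      have ht' : t ∈ Icc α β := ⟨ht.1, ht.2.trans ht₀.2⟩
      have hmt : m t ≤ M / 2 := hmt₀ ▸ hmm ht.2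
      simp only at hgt
      have h5 : κ * (M - m t) ≤ M := by
        by_contra h
        nlinarith [(hF0 t ht').1]
      have h6 : M - m t ≤ 1 / κ * M := by
        rw [one_div_mul_eq_div, le_div_iff₀ hκ0]; linarith
      refine ⟨t, ht', by linarith, by nlinarith, ?_, by linarith⟩
      nlinarith [mul_pos hF hM]
  · push Not at h1
    obtain ⟨t, ht, hgt⟩ : 0 ∈ (fun t => f t * M - κ * F * m t) '' Icc t₀ β := by
      refine intermediate_value_Icc' ht₀.2 (by fun_prop) ⟨?_, ?_⟩
      · simp only [hfβ, hmβ]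
        nlinarith [mul_pos hF hM]
      · linarith
    have ht' : t ∈ Icc α β := ⟨ht₀.1.trans ht.1, ht.2⟩
    have hmt : M / 2 ≤ m t := hmt₀ ▸ hmm ht.1
    simp only at hgt
    have h5 : κ * m t ≤ M := by
      by_contra h
      nlinarith [(hF0 t ht').2]
    have h6 : m t ≤ 1 / κ * M := by
      rw [one_div_mul_eq_div, le_div_iff₀ hκ0]; linarith
    refine ⟨t, ht', by nlinarith, by linarith, by linarith, ?_⟩
    nlinarith [mul_pos hF hM]

/-- The open box with corners `a` and `b`. -/
def openBox {n : ℕ} (a b : Fin n → ℝ) : Set (Fin n → ℝ) := univ.pi fun i => Ioo (a i) (b i)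

section Boxes

variable {n : ℕ} {a b : Fin n → ℝ} {i : Fin n} {t : ℝ} {μ : Measure (Fin n → ℝ)}
  {f : (Fin n → ℝ) → ℝ}

lemma mem_openBox {x : Fin n → ℝ} : x ∈ openBox a b ↔ ∀ i, a i < x i ∧ x i < b i := by
  simp [openBox]

lemma isBox_openBox (h : ∀ i, a i < b i) : IsBox (openBox a b) := ⟨a, b, h, rfl⟩

lemma measurableSet_openBox : MeasurableSet (openBox a b) :=
  MeasurableSet.univ_pi fun _ => measurableSet_Ioo

lemma measure_openBox_lt_top [IsLocallyFiniteMeasure μ] : μ (openBox a b) < ⊤ := by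
  refine (measure_mono fun x hx => ?_).trans_lt (isCompact_Icc (a := a) (b := b)).measure_lt_top
  rw [mem_openBox] at hx
  exact ⟨fun i => (hx i).1.le, fun i => (hx i).2.le⟩

lemma openBox_update_right (ht : t ≤ b i) :
    openBox a (Function.update b i t) = openBox a b ∩ {x | x i < t} := by
  ext x
  simp only [mem_openBox, mem_inter_iff, mem_ofPred_eq]
  constructor
  · intro h
    have hi := h i
    rw [Function.update_self] at hi
    refine ⟨fun j => ?_, hi.2⟩
    rcases eq_or_ne j i with rfl | hj
    · exact ⟨hi.1, hi.2.trans_le ht⟩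
    · have := h j
      rwa [Function.update_of_ne hj] at this
  · rintro ⟨h, hi⟩ j
    rcases eq_or_ne j i with rfl | hj
    · rw [Function.update_self]; exact ⟨(h j).1, hi⟩
    · rw [Function.update_of_ne hj]; exact h j

lemma openBox_update_left (ht : a i ≤ t) :
    openBox (Function.update a i t) b = openBox a b ∩ {x | t < x i} := by
  ext x
  simp only [mem_openBox, mem_inter_iff, mem_ofPred_eq]
  constructor
  · intro h
    have hi := h i
    rw [Function.update_self] at hi
    refine ⟨fun j => ?_, hi.1⟩
    rcases eq_or_ne j i with rfl | hj
    · exact ⟨ht.trans_lt hi.1, hi.2⟩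
    · have := h j
      rwa [Function.update_of_ne hj] at this
  · rintro ⟨h, hi⟩ j
    rcases eq_or_ne j i with rfl | hj
    · rw [Function.update_self]; exact ⟨hi, (h j).2⟩
    · rw [Function.update_of_ne hj]; exact h j

lemma restrict_openBox_cut (hμ : NullHyperplanes μ) (ht : t ∈ Ioo (a i) (b i)) :
    μ.restrict (openBox a b) = μ.restrict (openBox a (Function.update b i t)) +
      μ.restrict (openBox (Function.update a i t) b) := by
  rw [openBox_update_right ht.2.le, openBox_update_left ht.1.le, ← Measure.restrict_union]
  · refine Measure.restrict_congr_set ?_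
    have : ∀ᵐ x ∂μ, x i ≠ t := by
      rw [ae_iff]; simpa using hμ i t
    refine eventuallyEq_set.2 ?_
    filter_upwards [this] with x hx
    rcases lt_or_gt_of_ne hx with h | h <;> simp [h, h.not_gt]
  · exact Set.disjoint_left.2 fun x hx hx' => lt_asymm (a := x i) (b := t) hx.2 hx'.2
  · exact measurableSet_openBox.inter (measurableSet_lt measurable_const (measurable_pi_apply i))

lemma integrableOn_openBox_cut (hμ : NullHyperplanes μ) (ht : t ∈ Ioo (a i) (b i)) :
    IntegrableOn f (openBox a b) μ ↔ IntegrableOn f (openBox a (Function.update b i t)) μ ∧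
      IntegrableOn f (openBox (Function.update a i t) b) μ := by
  rw [IntegrableOn, restrict_openBox_cut hμ ht, integrable_add_measure]
  rfl

lemma setIntegral_openBox_cut (hμ : NullHyperplanes μ) (ht : t ∈ Ioo (a i) (b i))
    (hf : IntegrableOn f (openBox a b) μ) :
    ∫ x in openBox a b, f x ∂μ = (∫ x in openBox a (Function.update b i t), f x ∂μ) +
      ∫ x in openBox (Function.update a i t) b, f x ∂μ := by
  obtain ⟨h1, h2⟩ := (integrableOn_openBox_cut hμ ht).1 hf
  rw [restrict_openBox_cut hμ ht, integral_add_measure h1 h2]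

lemma measureReal_openBox_cut [IsLocallyFiniteMeasure μ] (hμ : NullHyperplanes μ)
    (ht : t ∈ Ioo (a i) (b i)) :
    μ.real (openBox a b) = μ.real (openBox a (Function.update b i t)) +
      μ.real (openBox (Function.update a i t) b) := by
  simpa using setIntegral_openBox_cut (f := fun _ => 1) hμ ht
    (integrableOn_const measure_openBox_lt_top.ne)

lemma continuous_integral_cut (hμ : NullHyperplanes μ) {R : Set (Fin n → ℝ)}
    (hf : IntegrableOn f R μ) : Continuous fun t => ∫ x in R ∩ {x | x i < t}, f x ∂μ := by
  have hS : ∀ t, MeasurableSet {x : Fin n → ℝ | x i < t} := fun t =>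
    measurableSet_lt (measurable_pi_apply i) measurable_const
  have h : (fun t => ∫ x in R ∩ {x | x i < t}, f x ∂μ) =
      fun t => ∫ x in R, {x | x i < t}.indicator f x ∂μ := by
    ext t; rw [setIntegral_indicator (hS t)]
  rw [h, continuous_iff_continuousAt]
  intro t₀
  refine continuousAt_of_dominated (bound := fun x => ‖f x‖)
    (Eventually.of_forall fun t => hf.aestronglyMeasurable.indicator (hS t))
    (Eventually.of_forall fun t => Eventually.of_forall fun x => norm_indicator_le_norm_self _ _)
    hf.norm ?_
  have : ∀ᵐ x ∂μ.restrict R, x i ≠ t₀ := ae_restrict_of_ae (by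
    rw [ae_iff]; simpa using hμ i t₀)
  filter_upwards [this] with x hx
  rcases lt_or_gt_of_ne hx with h | h
  · refine (continuousAt_const (y := f x)).congr ?_
    filter_upwards [lt_mem_nhds h] with t ht
    exact (indicator_of_mem (s := {x : Fin n → ℝ | x i < t}) ht f).symm
  · refine (continuousAt_const (y := (0 : ℝ))).congr ?_
    filter_upwards [gt_mem_nhds h] with t ht
    exact (indicator_of_notMem (s := {x : Fin n → ℝ | x i < t}) (not_lt.2 (le_of_lt ht)) f).symm

lemma monotone_integral_cut {R : Set (Fin n → ℝ)} (hf : IntegrableOn f R μ)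
    (hf0 : ∀ᵐ x ∂μ, 0 ≤ f x) : Monotone fun t => ∫ x in R ∩ {x | x i < t}, f x ∂μ := by
  intro t t' h
  refine setIntegral_mono_set (hf.mono_set inter_subset_left) (ae_restrict_of_ae hf0) ?_
  exact Eventually.of_forall fun x hx => ⟨hx.1, lt_of_lt_of_le hx.2 h⟩

/-- Every box can be cut by a hyperplane orthogonal to a given axis into two boxes of comparable
measure on which the average of `w` does not exceed `κ` times its average on the whole box. -/
lemma exists_cut [IsLocallyFiniteMeasure μ] (hμ : NullHyperplanes μ) (hab : ∀ i, a i < b i)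
    (i : Fin n) {w : (Fin n → ℝ) → ℝ} (hw0 : ∀ᵐ x ∂μ, 0 ≤ w x)
    (hw : IntegrableOn w (openBox a b) μ) (hm : 0 < μ.real (openBox a b))
    (hI : 0 < ∫ x in openBox a b, w x ∂μ) {κ : ℝ} (hκ : 1 < κ) (hκ2 : κ ≤ 2) :
    ∃ t ∈ Ioo (a i) (b i),
      (1 - 1 / κ) * μ.real (openBox a b) ≤ μ.real (openBox a (Function.update b i t)) ∧
      (1 - 1 / κ) * μ.real (openBox a b) ≤ μ.real (openBox (Function.update a i t) b) ∧
      (∫ x in openBox a (Function.update b i t), w x ∂μ) * μ.real (openBox a b) ≤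
        κ * (∫ x in openBox a b, w x ∂μ) * μ.real (openBox a (Function.update b i t)) ∧
      (∫ x in openBox (Function.update a i t) b, w x ∂μ) * μ.real (openBox a b) ≤
        κ * (∫ x in openBox a b, w x ∂μ) * μ.real (openBox (Function.update a i t) b) := by
  have h1 : IntegrableOn (fun _ => (1 : ℝ)) (openBox a b) μ :=
    integrableOn_const measure_openBox_lt_top.ne
  have hα : openBox a b ∩ {x | x i < a i} = ∅ := by
    ext x
    simp only [mem_inter_iff, mem_ofPred_eq, mem_empty_iff_false, iff_false, not_and, mem_openBox]
    exact fun h => not_lt.2 (h i).1.le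
  have hβ : openBox a b ∩ {x | x i < b i} = openBox a b :=
    inter_eq_left.2 fun x hx => (mem_openBox.1 hx i).2
  obtain ⟨t, ht, c1, c2, c3, c4⟩ := exists_balanced_cut (α := a i) (β := b i)
    (F := ∫ x in openBox a b, w x ∂μ) (M := μ.real (openBox a b)) (hab i).le
    (continuous_integral_cut (i := i) hμ hw) (continuous_integral_cut (i := i) hμ h1)
    (monotone_integral_cut hw hw0) (monotone_integral_cut h1 (by simp))
    (by simp [hα]) (by simp [hα]) (by simp only [hβ]) (by simp [hβ]) hI hm hκ hκ2
  simp only [← openBox_update_right ht.2.le] at c1 c2 c3 c4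
  simp only [integral_const, smul_eq_mul, mul_one, measureReal_restrict_apply_univ] at c1 c2 c3 c4
  have e1 := sub_eq_of_eq_add' (measureReal_openBox_cut hμ ht)
  have e2 := sub_eq_of_eq_add' (setIntegral_openBox_cut hμ ht hw)
  rw [e1] at c2 c4
  rw [e2] at c4
  exact ⟨t, ht, c1, c2, c3, c4⟩

lemma sum_update_right (a b : Fin n → ℝ) (i : Fin n) (t : ℝ) :
    ∑ j, (Function.update b i t j - a j) = ∑ j, (b j - a j) - (b i - t) := by
  have : ∀ j, Function.update b i t j - a j = (b j - a j) - if j = i then b i - t else 0 := by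
    intro j
    rcases eq_or_ne j i with rfl | h
    · simp
    · simp [h]
  simp [this]

lemma sum_update_left (a b : Fin n → ℝ) (i : Fin n) (t : ℝ) :
    ∑ j, (b j - Function.update a i t j) = ∑ j, (b j - a j) - (t - a i) := by
  have : ∀ j, b j - Function.update a i t j = (b j - a j) - if j = i then t - a i else 0 := by
    intro j
    rcases eq_or_ne j i with rfl | h
    · simp
    · simp [h]
  simp [this]

lemma exists_longest_side (hn : 1 ≤ n) (a b : Fin n → ℝ) :
    ∃ i, ∑ j, (b j - a j) ≤ n * (b i - a i) := by
  have : Nonempty (Fin n) := ⟨⟨0, hn⟩⟩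
  obtain ⟨i, hi⟩ := Finite.exists_max fun i => b i - a i
  refine ⟨i, (Finset.sum_le_sum fun j _ => hi j).trans_eq ?_⟩
  rw [Finset.sum_const, Finset.card_univ, Fintype.card_fin, nsmul_eq_mul]

lemma forall_lt_update_right (hab : ∀ j, a j < b j) (ht : a i < t) :
    ∀ j, a j < Function.update b i t j := by
  intro j
  rcases eq_or_ne j i with rfl | h
  · simpa
  · simpa [h] using hab j

lemma forall_update_left_lt (hab : ∀ j, a j < b j) (ht : t < b i) :
    ∀ j, Function.update a i t j < b j := by
  intro j
  rcases eq_or_ne j i with rfl | h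
  · simpa
  · simpa [h] using hab j

end Boxes

lemma boxAvg_eq {n : ℕ} (μ : Measure (Fin n → ℝ)) (R : Set (Fin n → ℝ)) (f : (Fin n → ℝ) → ℝ) :
    boxAvg μ R f = (∫ x in R, f x ∂μ) / μ.real R := by
  rw [boxAvg, setAverage_eq, smul_eq_mul, inv_mul_eq_div]

lemma rpow_boxAvg_le {n : ℕ} {μ : Measure (Fin n → ℝ)} {R : Set (Fin n → ℝ)}
    {f : (Fin n → ℝ) → ℝ} {r : ℝ} (hr : 1 ≤ r) (h0 : 0 < μ R) (ht : μ R < ⊤)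
    (hf0 : ∀ᵐ x ∂μ, 0 ≤ f x) (hf : IntegrableOn f R μ)
    (hfr : IntegrableOn (fun x => f x ^ r) R μ) :
    boxAvg μ R f ^ r ≤ boxAvg μ R fun x => f x ^ r :=
  (convexOn_rpow hr).map_set_average_le (Real.continuous_rpow_const (by linarith)).continuousOn
    isClosed_Ici h0.ne' ht.ne (ae_restrict_of_ae hf0) hf hfr

/-- The reverse Hölder classes decrease with the exponent. -/
lemma RHBound.mono_exponent {n : ℕ} {μ : Measure (Fin n → ℝ)} {w : (Fin n → ℝ) → ℝ} {q r C : ℝ}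
    (hq : 1 ≤ q) (hqr : q ≤ r) (hwm : Measurable w) (hw : ∀ᵐ x ∂μ, 0 < w x)
    (h : RHBound μ w r C) : RHBound μ w q C := by
  intro R hR h0 ht
  obtain ⟨hi, hir, hb⟩ := h R hR h0 ht
  have hq0 : 0 < q := by linarith
  have hr0 : 0 < r := by linarith
  have hiq : IntegrableOn (fun x => w x ^ q) R μ := by
    refine (hi.add hir).mono' (hwm.pow_const q).aestronglyMeasurable ?_
    filter_upwards [ae_restrict_of_ae hw] with x hx
    rw [Real.norm_of_nonneg (by positivity), Pi.add_apply]
    rcases le_total (w x) 1 with h1 | h1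
    · have := Real.rpow_le_rpow_of_exponent_ge hx h1 hq
      rw [Real.rpow_one] at this
      have : 0 ≤ w x ^ r := by positivity
      linarith
    · have := Real.rpow_le_rpow_of_exponent_le h1 hqr
      linarith
  refine ⟨hi, hiq, le_trans ?_ hb⟩
  have key := rpow_boxAvg_le (f := fun x => w x ^ q) (r := r / q) ((one_le_div hq0).2 hqr) h0 ht
    (hw.mono fun x hx => by positivity) hiq ?_
  · have h0q : 0 ≤ boxAvg μ R fun x => w x ^ q := by
      rw [boxAvg_eq]
      refine div_nonneg (integral_nonneg_of_ae ?_) measureReal_nonneg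
      filter_upwards [ae_restrict_of_ae hw] with x hx
      simp only [Pi.zero_apply]; positivity
    have e : (boxAvg μ R fun x => (w x ^ q) ^ (r / q)) = boxAvg μ R fun x => w x ^ r := by
      refine integral_congr_ae ?_
      filter_upwards [(ae_restrict_of_ae hw : ∀ᵐ x ∂μ.restrict R, 0 < w x).filter_mono
        (Measure.ae_smul_measure_le _)] with x hx
      rw [← Real.rpow_mul hx.le, mul_div_cancel₀ _ hq0.ne']
    rw [e] at key
    have := Real.rpow_le_rpow (by positivity) key (one_div_pos.2 hr0).le
    rwa [← Real.rpow_mul h0q, show r / q * (1 / r) = 1 / q by field_simp] at this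
  · refine hir.congr ?_
    filter_upwards [ae_restrict_of_ae hw] with x hx
    rw [← Real.rpow_mul hx.le, mul_div_cancel₀ _ hq0.ne']

/-- The plane `bellmanPlane` in homogeneous coordinates, where `m`, `I`, `J` stand for the measure
of a set and for the integrals over it of a weight and of its `p`-th power. -/
def massPlane (p q E s m I J : ℝ) : ℝ :=
  q * (q - 1) / E * s ^ (q - p) * J - p * q * (q - p) * s ^ (q - 1) * I +
    (p - 1) * (q - 1) * (q - p) * s ^ q * m

lemma massPlane_add (p q E s m₁ m₂ I₁ I₂ J₁ J₂ : ℝ) :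
    massPlane p q E s (m₁ + m₂) (I₁ + I₂) (J₁ + J₂) =
      massPlane p q E s m₁ I₁ J₁ + massPlane p q E s m₂ I₂ J₂ := by
  unfold massPlane; ring

lemma massPlane_eq {p q E s m I J : ℝ} (hm : 0 < m) (hI : 0 < I) (hs : 0 < s) :
    massPlane p q E s m I J =
      m * (I / m) ^ q * bellmanPlane p q E (s / (I / m)) (J / m / (I / m) ^ p) := by
  obtain ⟨x, hx⟩ : ∃ x, x = I / m := ⟨_, rfl⟩
  have hx0 : 0 < x := hx ▸ div_pos hI hm
  obtain ⟨y, hy⟩ : ∃ y, y = s / x := ⟨_, rfl⟩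
  have hy0 : 0 < y := hy ▸ div_pos hs hx0
  have hs' : s = y * x := by rw [hy]; field_simp
  have hI' : I = x * m := by rw [hx]; field_simp
  have h1 := (Real.rpow_pos_of_pos hx0 p).ne'
  rw [← hx, ← hy, massPlane, bellmanPlane, hs', hI', Real.mul_rpow hy0.le hx0.le,
    Real.mul_rpow hy0.le hx0.le, Real.mul_rpow hy0.le hx0.le, Real.rpow_sub hx0,
    Real.rpow_sub_one hx0.ne']
  field_simp

section Weight

variable {n : ℕ} {μ : Measure (Fin n → ℝ)} {w : (Fin n → ℝ) → ℝ} {p q Q E κ c : ℝ}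

lemma RHBound.openBox_estimates [IsLocallyFiniteMeasure μ] (hp : 1 < p) (hQ : 0 < Q)
    (hw : ∀ᵐ x ∂μ, 0 < w x) (hRH : RHBound μ w p Q) {a b : Fin n → ℝ} (hab : ∀ i, a i < b i)
    (h0 : 0 < μ (openBox a b)) :
    IntegrableOn w (openBox a b) μ ∧ IntegrableOn (fun x => w x ^ p) (openBox a b) μ ∧
      0 < μ.real (openBox a b) ∧ 0 < ∫ x in openBox a b, w x ∂μ ∧
      1 ≤ (∫ x in openBox a b, w x ^ p ∂μ) / μ.real (openBox a b) /
        ((∫ x in openBox a b, w x ∂μ) / μ.real (openBox a b)) ^ p ∧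
      (∫ x in openBox a b, w x ^ p ∂μ) / μ.real (openBox a b) /
        ((∫ x in openBox a b, w x ∂μ) / μ.real (openBox a b)) ^ p ≤ Q ^ p := by
  obtain ⟨hi, hip, hb⟩ := hRH _ (isBox_openBox hab) h0 measure_openBox_lt_top
  have hm : 0 < μ.real (openBox a b) := ENNReal.toReal_pos h0.ne' measure_openBox_lt_top.ne
  have hI : 0 < ∫ x in openBox a b, w x ∂μ := by
    refine (integral_pos_iff_support_of_nonneg_ae ?_ hi).2 ?_
    · filter_upwards [ae_restrict_of_ae hw] with x hx using hx.le
    · have : Function.support w =ᵐ[μ.restrict (openBox a b)] univ := by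
        refine eventuallyEq_univ.2 ?_
        filter_upwards [ae_restrict_of_ae hw] with x hx using hx.ne'
      rw [measure_congr this]
      simpa using h0
  have hx : 0 < (∫ x in openBox a b, w x ∂μ) / μ.real (openBox a b) := div_pos hI hm
  have h1 := rpow_boxAvg_le hp.le h0 measure_openBox_lt_top (hw.mono fun x hx => hx.le) hi hip
  rw [boxAvg_eq, boxAvg_eq] at h1 hb
  refine ⟨hi, hip, hm, hI, (one_le_div (by positivity)).2 h1, ?_⟩
  rw [div_le_iff₀ (by positivity), ← Real.mul_rpow hQ.le hx.le]
  have h2 : 0 ≤ (∫ x in openBox a b, w x ^ p ∂μ) / μ.real (openBox a b) :=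
    le_trans (by positivity) h1
  have := Real.rpow_le_rpow (by positivity) hb (by linarith : 0 ≤ p)
  rwa [← Real.rpow_mul h2, one_div_mul_cancel (by linarith), Real.rpow_one] at this

/-- Averaging `w` costs at most twice its distance to `φ` plus the oscillation of `φ`. -/
lemma setIntegral_abs_average_sub_le [IsLocallyFiniteMeasure μ] {a b : Fin n → ℝ}
    (hab : ∀ i, a i < b i) (hm : 0 < μ.real (openBox a b)) (hw : IntegrableOn w (openBox a b) μ)
    {φ : (Fin n → ℝ) → ℝ} (hφ : IntegrableOn φ (openBox a b) μ) {δ Λ : ℝ} (hΛ : 0 ≤ Λ)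
    (hosc : ∀ x y, |φ x - φ y| ≤ δ + Λ * ∑ i, |x i - y i|) :
    ∫ x in openBox a b, |(∫ y in openBox a b, w y ∂μ) / μ.real (openBox a b) - w x| ∂μ ≤
      2 * ((∫ x in openBox a b, |w x - φ x| ∂μ) + δ * μ.real (openBox a b) +
        Λ * (∑ i, (b i - a i)) * μ.real (openBox a b)) := by
  obtain ⟨z, hz⟩ : (openBox a b).Nonempty := by
    refine ⟨fun i => (a i + b i) / 2, mem_openBox.2 fun i => ?_⟩
    have := hab i
    constructor <;> linarith
  set R := openBox a b
  set m := μ.real R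
  set d := φ z
  set A := (∫ y in R, w y ∂μ) / m with hA
  have hc : ∀ e : ℝ, IntegrableOn (fun _ => e) R μ := fun e =>
    integrableOn_const measure_openBox_lt_top.ne
  have hwd : IntegrableOn (fun x => |w x - d|) R μ := (hw.sub (hc d)).abs
  have hwφ : IntegrableOn (fun x => |w x - φ x|) R μ := (hw.sub hφ).abs
  have h1 : |A - d| * m ≤ ∫ x in R, |w x - d| ∂μ := by
    have e : (A - d) * m = ∫ x in R, (w x - d) ∂μ := by
      rw [integral_sub hw (hc d), setIntegral_const, hA, smul_eq_mul]
      field_simp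
      rw [mul_comm d]
    rw [← abs_of_pos hm, ← abs_mul, e]
    exact abs_integral_le_integral_abs
  have h2 : ∫ x in R, |w x - d| ∂μ ≤
      (∫ x in R, |w x - φ x| ∂μ) + (δ + Λ * ∑ i, (b i - a i)) * m := by
    have : ∫ x in R, (|w x - φ x| + (δ + Λ * ∑ i, (b i - a i))) ∂μ =
        (∫ x in R, |w x - φ x| ∂μ) + (δ + Λ * ∑ i, (b i - a i)) * m := by
      rw [integral_add hwφ (hc _), setIntegral_const, smul_eq_mul, mul_comm m]
    rw [← this]
    refine setIntegral_mono_on hwd (hwφ.add (hc _)) measurableSet_openBox fun x hx => ?_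
    have hs : ∑ i, |x i - z i| ≤ ∑ i, (b i - a i) := by
      refine Finset.sum_le_sum fun i _ => ?_
      have h1 := mem_openBox.1 hx i
      have h2 := mem_openBox.1 hz i
      rw [abs_le]
      constructor <;> linarith
    have := hosc x z
    have := mul_le_mul_of_nonneg_left hs hΛ
    have := abs_sub_le (w x) (φ x) d
    linarith
  have h3 : ∫ x in R, |A - w x| ∂μ ≤ |A - d| * m + ∫ x in R, |w x - d| ∂μ := by
    have : ∫ x in R, (|A - d| + |w x - d|) ∂μ = |A - d| * m + ∫ x in R, |w x - d| ∂μ := by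
      rw [integral_add (hc _) hwd, setIntegral_const, smul_eq_mul, mul_comm m]
    rw [← this]
    refine setIntegral_mono_on ((hc A).sub hw).abs ((hc _).add hwd) measurableSet_openBox
      fun x hx => ?_
    rw [abs_sub_comm (w x) d]
    exact abs_sub_le _ _ _
  linarith

/-- Step functions `g` adapted to `k`-fold partitions of a box: they approximate `w`, and the
integral of `g ^ q` is controlled by the Bellman function. -/
lemma exists_step_approximation [IsLocallyFiniteMeasure μ] (hn : 1 ≤ n) (hμ : NullHyperplanes μ)
    (hp : 1 < p) (hQ : 0 < Q) (hw : ∀ᵐ x ∂μ, 0 < w x) (hRH : RHBound μ w p Q)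
    (hκ : 1 < κ) (hκ2 : κ ≤ 2)
    (hanti : ∀ a r, 1 ≤ a → a ≤ κ → r ≤ Q ^ p →
      bellmanPlane p q E κ r ≤ bellmanPlane p q E a r)
    (hlow : ∀ a r, 1 ≤ a → 1 ≤ r → c ≤ bellmanPlane p q E a r) (k : ℕ) :
    ∀ a b : Fin n → ℝ, (∀ i, a i < b i) → 0 < μ (openBox a b) →
      ∃ g : (Fin n → ℝ) → ℝ, (∀ x, 0 ≤ g x) ∧ IntegrableOn g (openBox a b) μ ∧
        IntegrableOn (fun x => g x ^ q) (openBox a b) μ ∧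
        (∀ s, (∫ x in openBox a b, w x ∂μ) / μ.real (openBox a b) ≤ s →
          c * ∫ x in openBox a b, g x ^ q ∂μ ≤
            massPlane p q E s (μ.real (openBox a b)) (∫ x in openBox a b, w x ∂μ)
              (∫ x in openBox a b, w x ^ p ∂μ)) ∧
        ∀ (φ : (Fin n → ℝ) → ℝ) (δ Λ : ℝ), IntegrableOn φ (openBox a b) μ → 0 ≤ Λ →
          (∀ x y, |φ x - φ y| ≤ δ + Λ * ∑ i, |x i - y i|) →
          ∫ x in openBox a b, |g x - w x| ∂μ ≤
            2 * ((∫ x in openBox a b, |w x - φ x| ∂μ) + δ * μ.real (openBox a b) +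
              Λ * ((1 - (1 - 1 / κ) / n) ^ k * ∑ i, (b i - a i)) * μ.real (openBox a b)) := by
  have hκ0 : 0 < κ := by linarith
  have hκ1 : 1 / κ < 1 := by rw [div_lt_one hκ0]; exact hκ
  have hκ1' : 0 < 1 / κ := by positivity
  have hn' : (1 : ℝ) ≤ n := by exact_mod_cast hn
  have hθ : 0 ≤ 1 - (1 - 1 / κ) / n := by
    rw [sub_nonneg, div_le_one (by linarith)]; linarith
  induction k with
  | zero =>
    intro a b hab h0
    obtain ⟨hi, hip, hm, hI, hJ1, hJ2⟩ := hRH.openBox_estimates hp hQ hw hab h0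
    have hx := div_pos hI hm
    refine ⟨fun _ => (∫ x in openBox a b, w x ∂μ) / μ.real (openBox a b), fun _ => hx.le,
      integrableOn_const measure_openBox_lt_top.ne, integrableOn_const measure_openBox_lt_top.ne,
      fun s hs => ?_, fun φ δ Λ hφ hΛ hosc => ?_⟩
    · rw [massPlane_eq hm hI (hx.trans_le hs), setIntegral_const, smul_eq_mul, mul_comm]
      exact mul_le_mul_of_nonneg_left (hlow _ _ ((one_le_div hx).2 hs) hJ1) (by positivity)
    · simpa using setIntegral_abs_average_sub_le hab hm hi hφ hΛ hosc
  | succ k ih =>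
    intro a b hab h0
    obtain ⟨hi, hip, hm, hI, hJ1, hJ2⟩ := hRH.openBox_estimates hp hQ hw hab h0
    have hx := div_pos hI hm
    obtain ⟨i, hlong⟩ := exists_longest_side hn a b
    obtain ⟨t, ht, hm₁, hm₂, hI₁, hI₂⟩ := exists_cut hμ hab i (hw.mono fun x hx => hx.le) hi hm hI
      hκ hκ2
    have hcm : 0 < (1 - 1 / κ) * μ.real (openBox a b) := mul_pos (by linarith) hm
    obtain ⟨g₁, hg₁, hg₁i, hg₁q, hB₁, happ₁⟩ := ih a (Function.update b i t)
      (forall_lt_update_right hab ht.1) (ENNReal.toReal_pos_iff.1 (hcm.trans_le hm₁)).1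
    obtain ⟨g₂, hg₂, hg₂i, hg₂q, hB₂, happ₂⟩ := ih (Function.update a i t) b
      (forall_update_left_lt hab ht.2) (ENNReal.toReal_pos_iff.1 (hcm.trans_le hm₂)).1
    have hm₁0 := hcm.trans_le hm₁
    have hm₂0 := hcm.trans_le hm₂
    have hmadd := measureReal_openBox_cut hμ ht
    have hIadd := setIntegral_openBox_cut hμ ht hi
    have hJadd := setIntegral_openBox_cut hμ ht hip
    obtain ⟨g, hg⟩ : ∃ g : (Fin n → ℝ) → ℝ, g = fun x => if x i < t then g₁ x else g₂ x :=
      ⟨_, rfl⟩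
    have he₁ : ∀ x ∈ openBox a (Function.update b i t), g x = g₁ x := by
      intro x hx
      rw [openBox_update_right ht.2.le] at hx
      have : x i < t := hx.2
      simp [hg, this]
    have he₂ : ∀ x ∈ openBox (Function.update a i t) b, g x = g₂ x := by
      intro x hx
      rw [openBox_update_left ht.1.le] at hx
      have : t < x i := hx.2
      simp [hg, this.not_gt]
    have hgi : IntegrableOn g (openBox a b) μ := (integrableOn_openBox_cut hμ ht).2
      ⟨hg₁i.congr_fun (fun x hx => (he₁ x hx).symm) measurableSet_openBox,
        hg₂i.congr_fun (fun x hx => (he₂ x hx).symm) measurableSet_openBox⟩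
    have hgq : IntegrableOn (fun x => g x ^ q) (openBox a b) μ :=
      (integrableOn_openBox_cut hμ ht).2
        ⟨hg₁q.congr_fun (fun x hx => by simp only [he₁ x hx]) measurableSet_openBox,
          hg₂q.congr_fun (fun x hx => by simp only [he₂ x hx]) measurableSet_openBox⟩
    have hfar : ∀ s, κ * ((∫ x in openBox a b, w x ∂μ) / μ.real (openBox a b)) ≤ s →
        c * ∫ x in openBox a b, g x ^ q ∂μ ≤
          massPlane p q E s (μ.real (openBox a b)) (∫ x in openBox a b, w x ∂μ)
            (∫ x in openBox a b, w x ^ p ∂μ) := by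
      intro s hs
      rw [hmadd, hIadd, hJadd, massPlane_add, setIntegral_openBox_cut hμ ht hgq, mul_add]
      refine add_le_add ?_ ?_
      · rw [setIntegral_congr_fun measurableSet_openBox fun x hx => by simp only [he₁ x hx]; rfl]
        refine hB₁ s (le_trans ?_ hs)
        rw [div_le_iff₀ hm₁0, ← mul_div_assoc, div_mul_eq_mul_div, le_div_iff₀ hm]
        exact hI₁
      · rw [setIntegral_congr_fun measurableSet_openBox fun x hx => by simp only [he₂ x hx]; rfl]
        refine hB₂ s (le_trans ?_ hs)
        rw [div_le_iff₀ hm₂0, ← mul_div_assoc, div_mul_eq_mul_div, le_div_iff₀ hm]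
        exact hI₂
    refine ⟨g, fun x => ?_, hgi, hgq, fun s hs => ?_, fun φ δ Λ hφ hΛ hosc => ?_⟩
    · rw [hg]
      dsimp only
      split_ifs
      exacts [hg₁ x, hg₂ x]
    · rcases le_total (κ * ((∫ x in openBox a b, w x ∂μ) / μ.real (openBox a b))) s with h | h
      · exact hfar s h
      · refine (hfar _ le_rfl).trans ?_
        rw [massPlane_eq hm hI (by positivity), massPlane_eq hm hI (hx.trans_le hs),
          mul_div_cancel_right₀ _ hx.ne']
        exact mul_le_mul_of_nonneg_left
          (hanti _ _ ((one_le_div hx).2 hs) ((div_le_iff₀ hx).2 h) hJ2) (by positivity)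
    · obtain ⟨hφ₁, hφ₂⟩ := (integrableOn_openBox_cut hμ ht).1 hφ
      have h₁ := happ₁ φ δ Λ hφ₁ hΛ hosc
      have h₂ := happ₂ φ δ Λ hφ₂ hΛ hosc
      rw [sum_update_right] at h₁
      rw [sum_update_left] at h₂
      have hgw : IntegrableOn (fun x => |g x - w x|) (openBox a b) μ := (hgi.sub hi).abs
      have hwφ : IntegrableOn (fun x => |w x - φ x|) (openBox a b) μ := (hi.sub hφ).abs
      rw [setIntegral_openBox_cut hμ ht hgw, setIntegral_openBox_cut hμ ht hwφ,
        setIntegral_congr_fun (s := openBox a (Function.update b i t)) (g := fun x => |g₁ x - w x|)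
          measurableSet_openBox fun x hx => by simp only [he₁ x hx],
        setIntegral_congr_fun (s := openBox (Function.update a i t) b) (g := fun x => |g₂ x - w x|)
          measurableSet_openBox fun x hx => by simp only [he₂ x hx]]
      generalize μ.real (openBox a (Function.update b i t)) = m₁ at *
      generalize μ.real (openBox (Function.update a i t) b) = m₂ at *
      generalize μ.real (openBox a b) = m at *
      generalize ∑ j, (b j - a j) = L at *
      have hpow : 0 ≤ Λ * (1 - (1 - 1 / κ) / n) ^ k := by positivity
      have hL : (L - (b i - t)) * m₁ + (L - (t - a i)) * m₂ ≤
          (1 - (1 - 1 / κ) / n) * L * m := by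
        have h3 : (b i - t) * ((1 - 1 / κ) * m) ≤ (b i - t) * m₁ :=
          mul_le_mul_of_nonneg_left hm₁ (by linarith [ht.2])
        have h4 : (t - a i) * ((1 - 1 / κ) * m) ≤ (t - a i) * m₂ :=
          mul_le_mul_of_nonneg_left hm₂ (by linarith [ht.1])
        have h5 : L / n * ((1 - 1 / κ) * m) ≤ (b i - a i) * ((1 - 1 / κ) * m) := by
          refine mul_le_mul_of_nonneg_right ?_ hcm.le
          rw [div_le_iff₀ (by linarith)]
          linarith
        have h6 : (1 - (1 - 1 / κ) / n) * L * m = L * m - L / n * ((1 - 1 / κ) * m) := by ring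
        rw [h6, hmadd]
        rw [hmadd] at h3 h4 h5
        linarith
      have := mul_le_mul_of_nonneg_left hL hpow
      rw [pow_succ, hmadd]
      rw [hmadd] at this
      linarith

/-- A uniformly continuous bounded function has a modulus of continuity of the form
`δ + Λ * d` for every `δ > 0`. -/
lemma exists_affine_modulus {φ : (Fin n → ℝ) → ℝ} (hφ : Continuous φ) (hc : HasCompactSupport φ)
    {δ : ℝ} (hδ : 0 < δ) :
    ∃ Λ, 0 ≤ Λ ∧ ∀ x y, |φ x - φ y| ≤ δ + Λ * ∑ i, |x i - y i| := by
  obtain ⟨M, hM⟩ := hc.exists_bound_of_continuous hφ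
  obtain ⟨η, hη, huc⟩ := Metric.uniformContinuous_iff.1 (hc.uniformContinuous_of_continuous hφ) δ hδ
  have hM0 : 0 ≤ M := (norm_nonneg _).trans (hM 0)
  refine ⟨2 * M / η, by positivity, fun x y => ?_⟩
  have hd : dist x y ≤ ∑ i, |x i - y i| := by
    rw [dist_pi_le_iff (Finset.sum_nonneg fun i _ => abs_nonneg _)]
    intro i
    rw [Real.dist_eq]
    exact Finset.single_le_sum (f := fun i => |x i - y i|) (fun i _ => abs_nonneg _)
      (Finset.mem_univ i)
  have hΛ : 0 ≤ 2 * M / η := by positivity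
  rcases lt_or_ge (dist x y) η with h | h
  · have := huc h
    rw [Real.dist_eq] at this
    have : 0 ≤ 2 * M / η * ∑ i, |x i - y i| := mul_nonneg hΛ (dist_nonneg.trans hd)
    linarith
  · have h1 : |φ x - φ y| ≤ 2 * M := by
      have h1 := hM x
      have h2 := hM y
      rw [Real.norm_eq_abs] at h1 h2
      have := abs_sub (φ x) (φ y)
      linarith
    have h2 : 2 * M / η * η ≤ 2 * M / η * ∑ i, |x i - y i| :=
      mul_le_mul_of_nonneg_left (h.trans hd) hΛ
    rw [div_mul_cancel₀ _ hη.ne'] at h2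
    linarith

/-- Fatou's lemma for `q`-th powers along a sequence converging in `L¹`. -/
lemma setIntegral_rpow_le_of_tendsto {R : Set (Fin n → ℝ)} {g : ℕ → (Fin n → ℝ) → ℝ}
    (hq : 0 < q) (hw : ∀ᵐ x ∂μ, 0 < w x) (hwi : IntegrableOn w R μ)
    (hg : ∀ k x, 0 ≤ g k x) (hgi : ∀ k, IntegrableOn (g k) R μ)
    (hgq : ∀ k, IntegrableOn (fun x => g k x ^ q) R μ) {B : ℝ}
    (hB : ∀ k, ∫ x in R, g k x ^ q ∂μ ≤ B)
    (hlim : Tendsto (fun k => ∫ x in R, |g k x - w x| ∂μ) atTop (nhds 0)) :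
    IntegrableOn (fun x => w x ^ q) R μ ∧ ∫ x in R, w x ^ q ∂μ ≤ B := by
  have hq' : ENNReal.ofReal q ≠ 0 := (ENNReal.ofReal_pos.2 hq).ne'
  have hqt : (ENNReal.ofReal q).toReal = q := ENNReal.toReal_ofReal hq.le
  have hB0 : 0 ≤ B := (integral_nonneg fun x => Real.rpow_nonneg (hg 0 x) q).trans (hB 0)
  have hgn : ∀ k, (fun x => ‖g k x‖ ^ q) = fun x => g k x ^ q := fun k => by
    ext x; rw [Real.norm_of_nonneg (hg k x)]
  have hbound : ∀ k, eLpNorm (g k) (ENNReal.ofReal q) (μ.restrict R) ≤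
      ENNReal.ofReal (B ^ q⁻¹) := by
    intro k
    have hL : MemLp (g k) (ENNReal.ofReal q) (μ.restrict R) := by
      rw [← integrable_norm_rpow_iff (hgi k).aestronglyMeasurable hq' ENNReal.ofReal_ne_top, hqt,
        hgn]
      exact hgq k
    rw [hL.eLpNorm_eq_integral_rpow_norm hq' ENNReal.ofReal_ne_top, hqt, hgn]
    refine ENNReal.ofReal_le_ofReal (Real.rpow_le_rpow ?_ (hB k) (inv_pos.2 hq).le)
    exact integral_nonneg fun x => Real.rpow_nonneg (hg k x) q
  have hmeas : TendstoInMeasure (μ.restrict R) g atTop w := by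
    refine tendstoInMeasure_of_tendsto_eLpNorm one_ne_zero
      (fun k => (hgi k).aestronglyMeasurable) hwi.aestronglyMeasurable ?_
    have : ∀ k, eLpNorm (g k - w) 1 (μ.restrict R) =
        ENNReal.ofReal (∫ x in R, |g k x - w x| ∂μ) := by
      intro k
      rw [eLpNorm_one_eq_lintegral_enorm, ← ofReal_integral_norm_eq_lintegral_enorm
        ((hgi k).sub hwi)]
      rfl
    simp only [this]
    simpa using ENNReal.tendsto_ofReal hlim
  have hle := eLpNorm_le_of_tendstoInMeasure (Eventually.of_forall hbound) hmeas
    fun k => (hgi k).aestronglyMeasurable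
  have hL : MemLp w (ENNReal.ofReal q) (μ.restrict R) :=
    ⟨hwi.aestronglyMeasurable, hle.trans_lt ENNReal.ofReal_lt_top⟩
  have hwn : (fun x => ‖w x‖ ^ q) =ᵐ[μ.restrict R] fun x => w x ^ q := by
    filter_upwards [ae_restrict_of_ae hw] with x hx
    rw [Real.norm_of_nonneg hx.le]
  have hint := hL.integrable_norm_rpow hq' ENNReal.ofReal_ne_top
  rw [hqt] at hint
  refine ⟨hint.congr hwn, ?_⟩
  rw [hL.eLpNorm_eq_integral_rpow_norm hq' ENNReal.ofReal_ne_top, hqt,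
    ENNReal.ofReal_le_ofReal_iff (by positivity), integral_congr_ae hwn] at hle
  have h0 : 0 ≤ ∫ x in R, w x ^ q ∂μ := by
    refine integral_nonneg_of_ae ?_
    filter_upwards [ae_restrict_of_ae hw] with x hx using Real.rpow_nonneg hx.le q
  exact (Real.rpow_le_rpow_iff h0 hB0 (inv_pos.2 hq)).1 hle

/-- The Bellman function controls the integral of `w ^ q`. -/
lemma RHBound.bellman_bound [IsLocallyFiniteMeasure μ] (hn : 1 ≤ n) (hμ : NullHyperplanes μ)
    (hp : 1 < p) (hpq : p < q) (hQ : 0 < Q) (hw : ∀ᵐ x ∂μ, 0 < w x) (hRH : RHBound μ w p Q)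
    (hκ : 1 < κ) (hκ2 : κ ≤ 2) (hc : 0 < c)
    (hanti : ∀ a r, 1 ≤ a → a ≤ κ → r ≤ Q ^ p →
      bellmanPlane p q E κ r ≤ bellmanPlane p q E a r)
    (hlow : ∀ a r, 1 ≤ a → 1 ≤ r → c ≤ bellmanPlane p q E a r)
    {a b : Fin n → ℝ} (hab : ∀ i, a i < b i) (h0 : 0 < μ (openBox a b)) :
    IntegrableOn (fun x => w x ^ q) (openBox a b) μ ∧
      ∫ x in openBox a b, w x ^ q ∂μ ≤
        massPlane p q E (κ * ((∫ x in openBox a b, w x ∂μ) / μ.real (openBox a b)))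
          (μ.real (openBox a b)) (∫ x in openBox a b, w x ∂μ)
          (∫ x in openBox a b, w x ^ p ∂μ) / c := by
  obtain ⟨hi, -, hm, hI, -, -⟩ := hRH.openBox_estimates hp hQ hw hab h0
  have hx := div_pos hI hm
  choose g hg hgi hgq hgB happ using fun k =>
    exists_step_approximation hn hμ hp hQ hw hRH hκ hκ2 hanti hlow k a b hab h0
  refine setIntegral_rpow_le_of_tendsto (by linarith) hw hi hg hgi hgq (fun k => ?_) ?_
  · rw [le_div_iff₀' hc]
    exact hgB k _ (le_mul_of_one_le_left hx.le hκ.le)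
  have hθ0 : 0 ≤ 1 - (1 - 1 / κ) / n ∧ 1 - (1 - 1 / κ) / n < 1 := by
    have hκ0 : 0 < κ := by linarith
    have hκ1 : 1 / κ < 1 := by rw [div_lt_one hκ0]; exact hκ
    have hκ1' : 0 < 1 / κ := by positivity
    have hn' : (1 : ℝ) ≤ n := by exact_mod_cast hn
    have h1 : (1 - 1 / κ) / n ≤ 1 := by
      rw [div_le_one (by linarith)]; linarith
    have h2 : 0 < (1 - 1 / κ) / n := div_pos (by linarith) (by linarith)
    constructor <;> linarith
  have hpow := tendsto_pow_atTop_nhds_zero_of_lt_one hθ0.1 hθ0.2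
  rw [Metric.tendsto_atTop']
  intro ε hε
  set m := μ.real (openBox a b)
  set δ := ε / (4 * (1 + m)) with hδ
  have hδ0 : 0 < δ := by positivity
  have hfin : IsFiniteMeasure (μ.restrict (openBox a b)) :=
    isFiniteMeasure_restrict.2 measure_openBox_lt_top.ne
  obtain ⟨φ, hφc, hφ, hφcont, hφi⟩ := hi.exists_hasCompactSupport_integral_sub_le hδ0
  obtain ⟨Λ, hΛ, hosc⟩ := exists_affine_modulus hφcont hφc hδ0
  have htail : Tendsto (fun k => 2 * (Λ * ((1 - (1 - 1 / κ) / n) ^ k * ∑ i, (b i - a i)) * m))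
      atTop (nhds 0) := by
    simpa using (((hpow.mul_const (∑ i, (b i - a i))).const_mul Λ).mul_const m).const_mul 2
  obtain ⟨N, hN⟩ := eventually_atTop.1 (htail.eventually (gt_mem_nhds (half_pos hε)))
  refine ⟨N, fun k hk => ?_⟩
  have h1 := happ k φ δ Λ hφi hΛ hosc
  have h2 := hN k hk.le
  have h3 : 2 * (δ + δ * m) = ε / 2 := by
    rw [hδ]; field_simp; norm_num
  simp only [Real.norm_eq_abs] at hφ
  rw [Real.dist_eq, sub_zero, abs_of_nonneg (integral_nonneg fun x => abs_nonneg _)]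
  linarith

/-- Self-improvement of reverse Hölder classes for exponents `q > p`. -/
lemma RHBound.self_improvement [IsLocallyFiniteMeasure μ] (hn : 1 ≤ n) (hμ : NullHyperplanes μ)
    (hp : 1 < p) (hpq : p < q) (hQ : 0 < Q) (hw : ∀ᵐ x ∂μ, 0 < w x) (hRH : RHBound μ w p Q)
    (hE : 0 < E) (hκ : 1 < κ) (hκ2 : κ ≤ 2) (hc : 0 < c)
    (hanti : ∀ a r, 1 ≤ a → a ≤ κ → r ≤ Q ^ p →
      bellmanPlane p q E κ r ≤ bellmanPlane p q E a r)
    (hlow : ∀ a r, 1 ≤ a → 1 ≤ r → c ≤ bellmanPlane p q E a r) :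
    RHBound μ w q ((bellmanPlane p q E κ (Q ^ p) / c) ^ (1 / q)) := by
  rintro R ⟨a, b, hab, rfl⟩ h0 -
  change 0 < μ (openBox a b) at h0
  change IntegrableOn w (openBox a b) μ ∧ IntegrableOn (fun x => w x ^ q) (openBox a b) μ ∧
    boxAvg μ (openBox a b) (fun x => w x ^ q) ^ (1 / q) ≤ _ * boxAvg μ (openBox a b) w
  obtain ⟨hi, -, hm, hI, hJ1, hJ2⟩ := hRH.openBox_estimates hp hQ hw hab h0
  obtain ⟨hiq, hb⟩ := hRH.bellman_bound hn hμ hp hpq hQ hw hκ hκ2 hc hanti hlow hab h0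
  refine ⟨hi, hiq, ?_⟩
  have hq0 : 0 < q := by linarith
  have hx := div_pos hI hm
  rw [boxAvg_eq, boxAvg_eq]
  rw [massPlane_eq hm hI (by positivity), mul_div_cancel_right₀ _ hx.ne'] at hb
  have hmono : bellmanPlane p q E κ ((∫ x in openBox a b, w x ^ p ∂μ) / μ.real (openBox a b) /
      ((∫ x in openBox a b, w x ∂μ) / μ.real (openBox a b)) ^ p) ≤
      bellmanPlane p q E κ (Q ^ p) := by
    have : 0 ≤ q * (q - 1) / E * κ ^ (q - p) := by
      have : 0 < q - 1 := by linarith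
      positivity
    have := mul_le_mul_of_nonneg_left hJ2 this
    unfold bellmanPlane
    linarith
  have hpos : 0 ≤ bellmanPlane p q E κ (Q ^ p) / c :=
    div_nonneg (hc.le.trans ((hlow _ _ hκ.le hJ1).trans hmono)) hc.le
  have h0q : 0 ≤ ∫ x in openBox a b, w x ^ q ∂μ := by
    refine integral_nonneg_of_ae ?_
    filter_upwards [ae_restrict_of_ae hw] with x hx using Real.rpow_nonneg hx.le q
  have hmain : (∫ x in openBox a b, w x ^ q ∂μ) / μ.real (openBox a b) ≤
      bellmanPlane p q E κ (Q ^ p) / c *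
        ((∫ x in openBox a b, w x ∂μ) / μ.real (openBox a b)) ^ q := by
    rw [div_le_iff₀ hm]
    refine hb.trans ?_
    rw [div_le_iff₀ hc]
    have := mul_le_mul_of_nonneg_left hmono
      (by positivity : 0 ≤ μ.real (openBox a b) *
        ((∫ x in openBox a b, w x ∂μ) / μ.real (openBox a b)) ^ q)
    refine this.trans_eq ?_
    field_simp
  have := Real.rpow_le_rpow (by positivity) hmain (one_div_pos.2 hq0).le
  rwa [Real.mul_rpow hpos (by positivity), ← Real.rpow_mul hx.le, mul_one_div_cancel hq0.ne',
    Real.rpow_one] at this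

end Weight

/-- Self-improvement `RH_p^* ⊂ RH_q^*` for `1 ≤ q < 1/s⁺_p(Q)`, with a
constant independent of the dimension and of the measure. -/
theorem strong_RHp_self_improvement_to_RHq
    (p Q : ℝ) (hp : 1 < p) (hQ : 1 < Q)
    (sp : ℝ) (hsp_mem : sp ∈ Icc (0:ℝ) (1 / p))
    (hsp : (1 - p * sp) ^ (1 / p) * (1 - sp)⁻¹ = 1 / Q)
    (q : ℝ) (hq1 : 1 ≤ q) (hq2 : q < 1 / sp) :
    ∃ C : ℝ, 0 < C ∧
      ∀ n : ℕ, 1 ≤ n →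
        ∀ μ : Measure (Fin n → ℝ), IsLocallyFiniteMeasure μ → NullHyperplanes μ →
          ∀ w : (Fin n → ℝ) → ℝ, Measurable w → (∀ᵐ x ∂μ, 0 < w x) →
            RHBound μ w p Q → RHBound μ w q C := by
  rcases le_or_gt q p with hqp | hpq
  · exact ⟨Q, by linarith, fun n _ μ _ _ w hwm hw hRH => hRH.mono_exponent hq1 hqp hwm hw⟩
  · obtain ⟨E, κ, c, hE, hκ, hκ2, hc, hanti, hlow⟩ := exists_bellman_parameters hp hQ hsp hpq hq2
    have hpos : 0 < bellmanPlane p q E κ (Q ^ p) :=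
      hc.trans_le (hlow _ _ hκ.le (Real.one_le_rpow hQ.le (by linarith)))
    exact ⟨(bellmanPlane p q E κ (Q ^ p) / c) ^ (1 / q), by positivity,
      fun n hn μ _ hμ w _ hw hRH =>
        hRH.self_improvement hn hμ hp hpq (by linarith) hw hE hκ hκ2 hc hanti hlow⟩
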